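/- Let M ⊆ ℂ^p × ℂ^{q-1} × ℂ be such that for every a ∈ ℂ^p the fiber M_{(a,·)} ⊆ ℂ^q is pluripolar, let A ⊆ ℂ^p be locally pluriregular, let C := {(a,b') ∈ A × ℂ^{q-1} : the fiber M_{(a,b',·)} ⊆ ℂ is polar}, and fix (a_0,b'_0) ∈ C and r > 0 with U := Δ_{(a_0,b'_0)}(r). Then h*_{C∩U,U}(a_0,b'_0) ≤ h*_{(A∩Δ_{a_0}(r))×Δ_{b'_0}(r),U}(a_0,b'_0). -/

import Mathlib

open Set Metric Filter

noncomputable section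

section BasicDefs

variable {E : Type*} [NormedAddCommGroup E] [NormedSpace ℂ E]

/-- `u` is plurisubharmonic on the open set `Ω` : it is `[-∞,∞)`-valued on `Ω`, upper
semicontinuous on `Ω`, and its restriction to each complex line is subharmonic there; the
latter is expressed by the classical harmonic-majorant criterion: on every closed disc
(in the line parameter) contained in `Ω`, `u` is dominated by every function harmonic inside
the disc and continuous up to the boundary (written as the real part of a holomorphic
function, the disc being simply connected) that dominates `u` on the boundary circle. -/
def PshOn (u : E → EReal) (Ω : Set E) : Prop :=
  (∀ x ∈ Ω, u x < ⊤) ∧ UpperSemicontinuousOn u Ω ∧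
  ∀ (a b : E) (c : ℂ) (r : ℝ), 0 < r →
    (∀ t ∈ closedBall c r, a + t • b ∈ Ω) →
    ∀ f : ℂ → ℂ, ContinuousOn f (closedBall c r) →
      DifferentiableOn ℂ f (ball c r) →
      (∀ t ∈ sphere c r, u (a + t • b) ≤ ((f t).re : EReal)) →
      ∀ t ∈ closedBall c r, u (a + t • b) ≤ ((f t).re : EReal)

/-- A set `P` is pluripolar if `P ⊆ u⁻¹(-∞)` for some plurisubharmonic `u ≢ -∞` on the
whole space. -/
def Pluripolar (P : Set E) : Prop :=
  ∃ u : E → EReal, PshOn u univ ∧ (¬ ∀ x, u x = ⊥) ∧ ∀ x ∈ P, u x = ⊥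

/-- The defining family of the relative extremal function `h_{A,Ω}`. -/
def extrFamily (A Ω : Set E) : Set (E → EReal) :=
  {u | PshOn u Ω ∧ (∀ x ∈ Ω, u x ≤ 1) ∧ ∀ x ∈ A, u x ≤ 0}

/-- The relative extremal function `h_{A,Ω}`. -/
def relExtr (A Ω : Set E) (z : E) : EReal :=
  ⨆ u ∈ extrFamily A Ω, u z

/-- Upper semicontinuous regularization `u*`. -/
def uscReg (u : E → EReal) (z : E) : EReal :=
  Filter.limsup u (nhds z)

/-- `h*_{A,Ω}`. -/
def relExtrStar (A Ω : Set E) (z : E) : EReal :=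
  uscReg (relExtr A Ω) z

/-- A canonical exhaustion of an open set `Ω` by relatively compact open subsets
`Ω_k ⊆ Ω_{k+1} ⋐ Ω` with `⋃ k, Ω_k = Ω`. -/
def exhaust (Ω : Set E) (k : ℕ) : Set E :=
  {x | ‖x‖ < (k : ℝ) + 1 ∧ closedBall x (1 / ((k : ℝ) + 1)) ⊆ Ω}

/-- `ω_{A,Ω} = lim_k h*_{A∩Ω_k,Ω_k}` (a decreasing limit, hence the infimum) along an
exhaustion of `Ω`; the limit is independent of the chosen exhaustion. -/
def omegaRel (A Ω : Set E) (z : E) : EReal :=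
  ⨅ k : ℕ, relExtrStar (A ∩ exhaust Ω k) (exhaust Ω k) z

/-- `A` is locally pluriregular: `A ≠ ∅` and `h*_{A∩Ω,Ω}(a) = 0` for every `a ∈ A` and every
open neighborhood `Ω` of `a`. -/
def LocPluriregular (A : Set E) : Prop :=
  A.Nonempty ∧ ∀ a ∈ A, ∀ Ω : Set E, IsOpen Ω → a ∈ Ω → relExtrStar (A ∩ Ω) Ω a = 0

/-- An open set `Ω` is pseudoconvex if `Ω` is the whole space or
`z ↦ -log dist(z, ∂Ω)` is plurisubharmonic on `Ω`. -/
def Pseudoconvex (Ω : Set E) : Prop :=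
  IsOpen Ω ∧ (Ω = univ ∨
    PshOn (fun z => ((- Real.log (infDist z Ωᶜ) : ℝ) : EReal)) Ω)

/-- `M` is a relatively closed subset of `U`. -/
def RelClosedIn (M U : Set E) : Prop :=
  M ⊆ U ∧ closure M ∩ U ⊆ M

/-- `g ∈ O(Ω)` admits no holomorphic extension to any neighborhood of `a`. -/
def NoHolExtAt (g : E → ℂ) (Ω : Set E) (a : E) : Prop :=
  ¬ ∃ (V : Set E) (h : E → ℂ), IsOpen V ∧ a ∈ V ∧
      DifferentiableOn ℂ h V ∧ ∀ x ∈ V ∩ Ω, h x = g x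

end BasicDefs

section TwoFold

variable {E F : Type*} [NormedAddCommGroup E] [NormedSpace ℂ E]
  [NormedAddCommGroup F] [NormedSpace ℂ F]

/-- The 2-fold cross `𝕏(A,B;D,G) = (A×G) ∪ (D×B)`. -/
def Cross2 (A : Set E) (B : Set F) (D : Set E) (G : Set F) : Set (E × F) :=
  (A ×ˢ G) ∪ (D ×ˢ B)

/-- `X̂ = {(z,w) ∈ D×G : ω_{A,D}(z) + ω_{B,G}(w) < 1}`. -/
def CrossHat2 (A : Set E) (B : Set F) (D : Set E) (G : Set F) : Set (E × F) :=
  {p | p.1 ∈ D ∧ p.2 ∈ G ∧ omegaRel A D p.1 + omegaRel B G p.2 < 1}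

/-- `f ∈ O_s(X∖M)` for the 2-fold cross `X = 𝕏(A,B;D,G)`. -/
def SepHol2 (A : Set E) (B : Set F) (D : Set E) (G : Set F) (M : Set (E × F))
    (f : E × F → ℂ) : Prop :=
  (∀ a ∈ A, DifferentiableOn ℂ (fun w => f (a, w)) (G \ {w | (a, w) ∈ M})) ∧
  (∀ b ∈ B, DifferentiableOn ℂ (fun z => f (z, b)) (D \ {z | (z, b) ∈ M}))

end TwoFold

section NFold

variable {N : ℕ} {n : Fin N → ℕ}

/-- The `N`-fold cross `𝕏(A_1,…,A_N;D_1,…,D_N)`. -/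
def CrossN (A D : ∀ j : Fin N, Set (Fin (n j) → ℂ)) : Set (∀ j, Fin (n j) → ℂ) :=
  {z | ∃ j, z j ∈ D j ∧ ∀ i, i ≠ j → z i ∈ A i}

/-- `X̂ := {(z_1,…,z_N) ∈ D_1×⋯×D_N : Σ_j ω_{A_j,D_j}(z_j) < 1}`. -/
def CrossHatN (A D : ∀ j : Fin N, Set (Fin (n j) → ℂ)) : Set (∀ j, Fin (n j) → ℂ) :=
  {z | (∀ j, z j ∈ D j) ∧ ∑ j, omegaRel (A j) (D j) (z j) < 1}

/-- Insert the value `w` in the `j`-th slot of the partial tuple `y`. -/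
def glueAt (j : Fin N) (y : ∀ i : {i : Fin N // i ≠ j}, Fin (n i.1) → ℂ)
    (w : Fin (n j) → ℂ) : ∀ i, Fin (n i) → ℂ :=
  fun i => if h : i = j then cast (by rw [h]) w else y ⟨i, h⟩

/-- Forget the `j`-th slot of a tuple. -/
def dropAt (j : Fin N) (z : ∀ i, Fin (n i) → ℂ) :
    ∀ i : {i : Fin N // i ≠ j}, Fin (n i.1) → ℂ :=
  fun i => z i.1

/-- `Σ_j = {(z',z'') ∈ (A_1×⋯×A_{j-1})×(A_{j+1}×⋯×A_N) : M_{(z',·,z'')} not pluripolar}`. -/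
def SigmaSet (A : ∀ j : Fin N, Set (Fin (n j) → ℂ)) (M : Set (∀ j, Fin (n j) → ℂ))
    (j : Fin N) : Set (∀ i : {i : Fin N // i ≠ j}, Fin (n i.1) → ℂ) :=
  {y | (∀ i, y i ∈ A i.1) ∧ ¬ Pluripolar {w : Fin (n j) → ℂ | glueAt j y w ∈ M}}

/-- The generalized `N`-fold cross `𝕋(A_1,…,A_N;D_1,…,D_N;S_1,…,S_N)`. -/
def CrossT (A D : ∀ j : Fin N, Set (Fin (n j) → ℂ))
    (S : ∀ j : Fin N, Set (∀ i : {i : Fin N // i ≠ j}, Fin (n i.1) → ℂ)) :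
    Set (∀ j, Fin (n j) → ℂ) :=
  {z | ∃ j, z j ∈ D j ∧ (∀ i, i ≠ j → z i ∈ A i) ∧ dropAt j z ∉ S j}

/-- `f ∈ O_s(X∖M)` for the `N`-fold cross `X = 𝕏(A_1,…,A_N;D_1,…,D_N)`. -/
def SepHolN (A D : ∀ j : Fin N, Set (Fin (n j) → ℂ)) (M : Set (∀ j, Fin (n j) → ℂ))
    (f : (∀ j, Fin (n j) → ℂ) → ℂ) : Prop :=
  ∀ (j : Fin N) (a : ∀ i, Fin (n i) → ℂ), (∀ i, a i ∈ A i) →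
    DifferentiableOn ℂ (fun w => f (Function.update a j w))
      (D j \ {w | Function.update a j w ∈ M})

/-- `f ∈ O_s(T)` for the generalized cross `T = 𝕋(A;D;S)`. -/
def SepHolT (A D : ∀ j : Fin N, Set (Fin (n j) → ℂ))
    (S : ∀ j : Fin N, Set (∀ i : {i : Fin N // i ≠ j}, Fin (n i.1) → ℂ))
    (f : (∀ j, Fin (n j) → ℂ) → ℂ) : Prop :=
  ∀ (j : Fin N) (y : ∀ i : {i : Fin N // i ≠ j}, Fin (n i.1) → ℂ),
    (∀ i, y i ∈ A i.1) → y ∉ S j →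
    DifferentiableOn ℂ (fun w => f (glueAt j y w)) (D j)

end NFold

section PshLemmas

open MeasureTheory AddCircle

theorem PshOn.comp_affine {E F : Type*} [NormedAddCommGroup E] [NormedSpace ℂ E]
    [NormedAddCommGroup F] [NormedSpace ℂ F] {u : E → EReal} {Ω : Set E} (hu : PshOn u Ω)
    (L : F →L[ℂ] E) (e : E) {Ω' : Set F} (hΩ : ∀ x ∈ Ω', e + L x ∈ Ω) :
    PshOn (fun x => u (e + L x)) Ω' := by
  obtain ⟨h1, h2, h3⟩ := hu
  refine ⟨fun x hx => h1 _ (hΩ x hx), ?_, ?_⟩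
  · exact h2.comp (g := fun x => e + L x) (by fun_prop) hΩ
  · intro a b c r hr hsub f hf hf' hle t ht
    have key : ∀ t : ℂ, e + L (a + t • b) = (e + L a) + t • L b := by
      intro t; simp [add_assoc]
    simp only [key] at hle ⊢
    exact h3 (e + L a) (L b) c r hr (fun t ht => key t ▸ hΩ _ (hsub t ht)) f hf hf' hle t ht

/-- Harmonic majorant criterion on the closed unit disc of `ℂ`. -/
theorem PshOn.le_re_of_sphere {w : ℂ → EReal} {Ω : Set ℂ} (hw : PshOn w Ω)
    (hΩ : closedBall 0 1 ⊆ Ω) {f : ℂ → ℂ} (hf : Differentiable ℂ f)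
    (hle : ∀ t ∈ sphere (0 : ℂ) 1, w t ≤ ((f t).re : EReal)) :
    ∀ t ∈ closedBall (0 : ℂ) 1, w t ≤ ((f t).re : EReal) := by
  have := hw.2.2 0 1 0 1 one_pos (fun t ht => by simpa using hΩ ht) f hf.continuous.continuousOn
    hf.differentiableOn
  simpa using this (by simpa using hle)

theorem integral_fourier_of_ne_zero {n : ℤ} (hn : n ≠ 0) :
    ∫ x, fourier n x ∂(haarAddCircle : Measure (AddCircle (1 : ℝ))) = 0 :=
  integral_eq_zero_of_add_right_eq_neg (fourier_add_half_inv_index hn one_pos)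

theorem exists_polynomial_re_eq_of_mem_span_fourier {g : C(AddCircle (1 : ℝ), ℂ)}
    (hg : g ∈ Submodule.span ℂ (range (fourier (T := 1)))) (c : ℂ) :
    ∃ f : Polynomial ℂ, (∀ x, (f.eval (toCircle x : ℂ)).re = (c * g x).re) ∧
      (f.eval 0).re = (c * ∫ x, g x ∂haarAddCircle).re := by
  induction hg using Submodule.span_induction generalizing c with
  | mem g hg =>
    obtain ⟨n, rfl⟩ := hg
    have hpow (m : ℕ) (x : AddCircle (1 : ℝ)) : (fourier (m : ℤ) x : ℂ) = (toCircle x : ℂ) ^ m := by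
      rw [fourier_apply, natCast_zsmul, toCircle_nsmul]; simp
    rcases eq_or_ne n 0 with rfl | hn
    · refine ⟨.C c, ?_, ?_⟩ <;> simp
    rcases Int.eq_nat_or_neg n with ⟨m, rfl | rfl⟩
    · have hm : m ≠ 0 := by simpa using hn
      refine ⟨.C c * .X ^ m, fun x => ?_, ?_⟩
      · rw [hpow]; simp
      · rw [integral_fourier_of_ne_zero hn]; simp [hm]
    · have hm : m ≠ 0 := by simpa using hn
      refine ⟨.C (starRingEnd ℂ c) * .X ^ m, fun x => ?_, ?_⟩
      · rw [fourier_neg, hpow, ← Complex.conj_re]; simp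
      · rw [integral_fourier_of_ne_zero hn]; simp [hm]
  | zero => exact ⟨0, by simp⟩
  | add g₁ g₂ _ _ h₁ h₂ =>
    obtain ⟨f₁, hf₁, hf₁'⟩ := h₁ c
    obtain ⟨f₂, hf₂, hf₂'⟩ := h₂ c
    refine ⟨f₁ + f₂, fun x => ?_, ?_⟩
    · simp [hf₁, hf₂, mul_add]
    · have : ∫ x, (g₁ + g₂) x ∂haarAddCircle
          = (∫ x, g₁ x ∂haarAddCircle) + ∫ x, g₂ x ∂haarAddCircle :=
        integral_add (g₁.continuous.integrable_of_hasCompactSupport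
            (HasCompactSupport.of_compactSpace _))
          (g₂.continuous.integrable_of_hasCompactSupport (HasCompactSupport.of_compactSpace _))
      rw [this, Polynomial.eval_add, Complex.add_re, hf₁', hf₂', mul_add, Complex.add_re]
  | smul a g _ h =>
    obtain ⟨f, hf, hf'⟩ := h (c * a)
    refine ⟨f, fun x => ?_, ?_⟩
    · simp [hf, mul_assoc]
    · have : ∫ x, (a • g) x ∂haarAddCircle = a * ∫ x, g x ∂haarAddCircle :=
        integral_const_mul _ _
      rw [this, hf', mul_assoc]

theorem exists_polynomial_re_near (φ : C(AddCircle (1 : ℝ), ℝ)) {ε : ℝ} (hε : 0 < ε) :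
    ∃ f : Polynomial ℂ, (∀ x, φ x ≤ (f.eval (toCircle x : ℂ)).re) ∧
      (f.eval 0).re ≤ (∫ x, φ x ∂haarAddCircle) + ε := by
  set ψ : C(AddCircle (1 : ℝ), ℂ) := ⟨fun x => (φ x : ℂ), by fun_prop⟩
  have hmem : ψ ∈ (Submodule.span ℂ (range (fourier (T := 1)))).topologicalClosure := by
    rw [span_fourier_closure_eq_top]; trivial
  obtain ⟨g, hg, hdist⟩ := Metric.mem_closure_iff.1 hmem (ε / 2) (half_pos hε)
  obtain ⟨f, hf, hf'⟩ := exists_polynomial_re_eq_of_mem_span_fourier hg 1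
  have hnear (x) : |φ x - (g x).re| < ε / 2 := by
    have h1 := (ContinuousMap.dist_apply_le_dist (f := ψ) (g := g) x).trans_lt hdist
    rw [Complex.dist_eq] at h1
    simpa [ψ] using (Complex.abs_re_le_norm _).trans_lt h1
  have hint {β : Type} [NormedAddCommGroup β] {k : AddCircle (1 : ℝ) → β} (hk : Continuous k) :
      Integrable k haarAddCircle :=
    hk.integrable_of_hasCompactSupport (HasCompactSupport.of_compactSpace _)
  refine ⟨f + .C (ε / 2 : ℂ), fun x => ?_, ?_⟩
  · have := abs_lt.1 (hnear x)
    simp only [Polynomial.eval_add, Polynomial.eval_C, Complex.add_re, hf, one_mul]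
    norm_num
    linarith
  · have hre : (∫ x, g x ∂haarAddCircle).re = ∫ x, (g x).re ∂haarAddCircle :=
      (integral_re (hint g.continuous)).symm
    have hmono : ∫ x, (g x).re ∂haarAddCircle ≤ ∫ x, (φ x + ε / 2) ∂haarAddCircle := by
      refine integral_mono (hint (by fun_prop)) (hint (by fun_prop)) fun x => ?_
      have := abs_lt.1 (hnear x)
      simp only; linarith
    rw [integral_add (hint φ.continuous) (integrable_const _)] at hmono
    simp only [Polynomial.eval_add, Polynomial.eval_C, Complex.add_re, hf', one_mul, hre]
    norm_num at hmono ⊢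
    linarith

theorem exists_toCircle_eq {t : ℂ} (ht : t ∈ sphere (0 : ℂ) 1) :
    ∃ x : AddCircle (1 : ℝ), (toCircle x : ℂ) = t := by
  obtain ⟨x, hx⟩ := (homeomorphCircle (T := 1) one_ne_zero).surjective ⟨t, ht⟩
  exact ⟨x, by simpa [homeomorphCircle_apply] using congrArg Subtype.val hx⟩

theorem toCircle_mem_sphere (x : AddCircle (1 : ℝ)) : (toCircle x : ℂ) ∈ sphere (0 : ℂ) 1 :=
  (toCircle x).2

/-- Sub-mean value inequality against continuous majorants. -/
theorem PshOn.le_integral {w : ℂ → EReal} {Ω : Set ℂ} (hw : PshOn w Ω)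
    (hΩ : closedBall 0 1 ⊆ Ω) (φ : C(AddCircle (1 : ℝ), ℝ))
    (hφ : ∀ x, w (toCircle x) ≤ (φ x : EReal)) :
    w 0 ≤ ((∫ x, φ x ∂haarAddCircle : ℝ) : EReal) := by
  refine EReal.le_of_forall_lt_iff_le.1 fun z hz => ?_
  obtain ⟨f, hf, hf'⟩ := exists_polynomial_re_near φ (sub_pos.2 (EReal.coe_lt_coe_iff.1 hz))
  refine (hw.le_re_of_sphere hΩ f.differentiable (fun t ht => ?_) 0 (by simp)).trans
    (EReal.coe_le_coe_iff.2 (by linarith))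
  obtain ⟨x, rfl⟩ := exists_toCircle_eq ht
  exact (hφ x).trans (EReal.coe_le_coe_iff.2 (hf x))

/-- Harnack's inequality. -/
theorem re_le_three_mul_re_zero {f : ℂ → ℂ} (hf : Differentiable ℂ f)
    (hpos : ∀ t ∈ sphere (0 : ℂ) 1, 0 ≤ (f t).re) {z : ℂ} (hz : ‖z‖ ≤ 1 / 2) :
    (f z).re ≤ 3 * (f 0).re := by
  have hzb : z ∈ ball (0 : ℂ) 1 := by simp; linarith
  have hd : DiffContOnCl ℂ f (ball 0 1) := hf.diffContOnCl
  have hcont : ContinuousOn (Complex.re ∘ herglotzRieszKernel 0 z) (sphere 0 1) :=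
    Complex.continuous_re.comp_continuousOn (by
      simpa using continuousOn_herglotzRieszKernel_sphere hzb)
  have hfz := congrArg Complex.re (hd.circleAverage_re_herglotzRieszKernel_smul hzb)
  have hf0 := congrArg Complex.re ((by simpa using hd :
    DiffContOnCl ℂ f (ball 0 |1|)).circleAverage)
  have hi1 : CircleIntegrable ((Complex.re ∘ herglotzRieszKernel 0 z) • f) 0 1 :=
    (hcont.smul hf.continuous.continuousOn).circleIntegrable zero_le_one
  have hi2 : CircleIntegrable f 0 1 := hf.continuous.continuousOn.circleIntegrable zero_le_one
  have h1 := Complex.reCLM.circleAverage_comp_comm hi1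
  have h2 := Complex.reCLM.circleAverage_comp_comm hi2
  simp only [Complex.reCLM_apply] at h1 h2
  rw [← h1] at hfz
  rw [← h2] at hf0
  have h3 : Real.circleAverage (fun t => (3 : ℝ) • (Complex.reCLM ∘ f) t) 0 1
      = (3 : ℝ) • Real.circleAverage (Complex.reCLM ∘ f) 0 1 := Real.circleAverage_fun_smul
  rw [← hfz, ← hf0, ← smul_eq_mul, ← h3]
  refine Real.circleAverage_mono ?_ ?_ fun t ht => ?_
  · exact (Complex.continuous_re.comp_continuousOn
      (hcont.smul hf.continuous.continuousOn)).circleIntegrable zero_le_one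
  · exact ((Complex.continuous_re.comp hf.continuous).const_smul (3 : ℝ)).continuousOn
      |>.circleIntegrable zero_le_one
  · rw [abs_one] at ht
    have hk := re_herglotzRieszKernel_le ht hzb
    have hk3 : (1 + ‖z - 0‖) / (1 - ‖z - 0‖) ≤ 3 := by
      rw [sub_zero, div_le_iff₀ (by linarith)]; linarith
    simpa [herglotzRieszKernel_def] using
      mul_le_mul_of_nonneg_right (hk.trans hk3) (hpos t ht)

theorem PshOn.le_three_mul_integral {w : ℂ → EReal} {Ω : Set ℂ} (hw : PshOn w Ω)
    (hΩ : closedBall 0 1 ⊆ Ω) (φ : C(AddCircle (1 : ℝ), ℝ)) (hφ0 : ∀ x, 0 ≤ φ x)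
    (hφ : ∀ x, w (toCircle x) ≤ (φ x : EReal)) {z : ℂ} (hz : ‖z‖ ≤ 1 / 2) :
    w z ≤ ((3 * ∫ x, φ x ∂haarAddCircle : ℝ) : EReal) := by
  refine EReal.le_of_forall_lt_iff_le.1 fun y hy => ?_
  have hy' := EReal.coe_lt_coe_iff.1 hy
  obtain ⟨f, hf, hf'⟩ := exists_polynomial_re_near φ (ε := (y - 3 * ∫ x, φ x ∂haarAddCircle) / 3)
    (by linarith)
  have hH := re_le_three_mul_re_zero f.differentiable (z := z) (fun t ht => by
    obtain ⟨x, rfl⟩ := exists_toCircle_eq ht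
    exact (hφ0 x).trans (hf x)) hz
  refine (hw.le_re_of_sphere hΩ f.differentiable (fun t ht => ?_) z
    (by simp; linarith)).trans (EReal.coe_le_coe_iff.2 (by linarith))
  obtain ⟨x, rfl⟩ := exists_toCircle_eq ht
  exact (hφ x).trans (EReal.coe_le_coe_iff.2 (hf x))

theorem PshOn.upperSemicontinuous_toCircle {w : ℂ → EReal} {Ω : Set ℂ} (hw : PshOn w Ω)
    (hΩ : closedBall 0 1 ⊆ Ω) :
    UpperSemicontinuous (fun x : AddCircle (1 : ℝ) => w (toCircle x)) := by
  rw [← upperSemicontinuousOn_univ_iff]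
  exact hw.2.1.comp (g := fun x : AddCircle (1 : ℝ) => (toCircle x : ℂ))
    (continuous_subtype_val.comp continuous_toCircle).continuousOn
    fun x _ => hΩ (sphere_subset_closedBall (toCircle_mem_sphere x))

/-- If `w` is finite at the center of the disc, then it is finite almost everywhere on the
boundary circle. -/
theorem PshOn.ae_ne_bot {w : ℂ → EReal} {Ω : Set ℂ} (hw : PshOn w Ω)
    (hΩ : closedBall 0 1 ⊆ Ω) (h0 : w 0 ≠ ⊥) :
    ∀ᵐ x ∂(haarAddCircle : Measure (AddCircle (1 : ℝ))), w (toCircle x) ≠ ⊥ := by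
  have husc := hw.upperSemicontinuous_toCircle hΩ
  set v : AddCircle (1 : ℝ) → EReal := fun x => w (toCircle x)
  have hlt (x) : v x < ⊤ := hw.1 _ (hΩ (sphere_subset_closedBall (toCircle_mem_sphere x)))
  have hmeas : MeasurableSet {x | v x = ⊥} := husc.measurable (measurableSet_singleton ⊥)
  by_contra hne
  have hpos : 0 < haarAddCircle {x | v x = ⊥} := by
    rw [pos_iff_ne_zero]
    intro h
    exact hne (by rw [ae_iff]; simpa using h)
  obtain ⟨K, hKE, hK, hKpos⟩ := hmeas.exists_lt_isCompact_of_ne_top (measure_ne_top _ _) hpos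
  obtain ⟨x₀, -, hx₀⟩ := (upperSemicontinuousOn_univ_iff.2 husc).exists_isMaxOn
    univ_nonempty isCompact_univ
  obtain ⟨M₀, hM₀, -⟩ := EReal.lt_iff_exists_real_btwn.1 (hlt x₀)
  set M : ℝ := max M₀ 0
  have hM (x) : v x ≤ (M : EReal) :=
    (hx₀ (mem_univ x)).trans (hM₀.le.trans (EReal.coe_le_coe_iff.2 (le_max_left _ _)))
  have hM0 : 0 ≤ M := le_max_right _ _
  obtain ⟨m, hm⟩ : ∃ m : ℝ, w 0 = m :=
    ⟨_, (EReal.coe_toReal (hw.1 0 (hΩ (by simp))).ne h0).symm⟩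
  set κ : ℝ := haarAddCircle.real K
  have hκ : 0 < κ := ENNReal.toReal_pos hKpos.ne' (measure_ne_top _ _)
  set N : ℝ := (M + |m|) / κ + 1
  have hN : 0 ≤ N := by positivity
  have hNκ : N * κ = M + |m| + κ := by simp only [N]; field_simp
  have hopen : IsOpen {x | v x < ((-N : ℝ) : EReal)} := husc.isOpen_preimage _
  obtain ⟨χ, hχ0, hχ1, hχ⟩ := exists_continuous_zero_one_of_isClosed hopen.isClosed_compl
    hK.isClosed (disjoint_left.2 fun x hx hxK => hx (by
      have : v x = ⊥ := hKE hxK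
      exact this.trans_lt (EReal.bot_lt_coe _)))
  have hint {k : AddCircle (1 : ℝ) → ℝ} (hk : Continuous k) : Integrable k haarAddCircle :=
    hk.integrable_of_hasCompactSupport (HasCompactSupport.of_compactSpace _)
  have hχint : κ ≤ ∫ x, χ x ∂haarAddCircle := by
    change haarAddCircle.real K ≤ _
    rw [← integral_indicator_one hK.measurableSet]
    refine integral_mono ((integrable_const 1).indicator hK.measurableSet) (hint χ.continuous)
      fun x => ?_
    by_cases hx : x ∈ K
    · simpa [hx] using (hχ1 hx).ge
    · simpa [hx] using (hχ x).1
  have key := hw.le_integral hΩ ⟨fun x => M - (N + M) * χ x, by fun_prop⟩ fun x => by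
    simp only [ContinuousMap.coe_mk]
    by_cases hx : v x < ((-N : ℝ) : EReal)
    · refine hx.le.trans (EReal.coe_le_coe_iff.2 ?_)
      nlinarith [(hχ x).2]
    · have : χ x = 0 := hχ0 hx
      simpa [this] using hM x
  rw [hm, EReal.coe_le_coe_iff] at key
  simp only [ContinuousMap.coe_mk] at key
  rw [integral_sub (integrable_const _) (hint (by fun_prop)), integral_const_mul] at key
  simp at key
  nlinarith [neg_abs_le m]

/-- A subharmonic function bounded by `1` that is nonpositive almost everywhere on a circle is
nonpositive on the concentric disc of half the radius. -/
theorem PshOn.le_zero_of_ae {w : ℂ → EReal} {Ω : Set ℂ} (hw : PshOn w Ω)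
    (hΩ : closedBall 0 1 ⊆ Ω) (h1 : ∀ t ∈ Ω, w t ≤ 1)
    (hae : ∀ᵐ x ∂(haarAddCircle : Measure (AddCircle (1 : ℝ))), w (toCircle x) ≤ 0)
    {z : ℂ} (hz : ‖z‖ ≤ 1 / 2) : w z ≤ 0 := by
  have husc := hw.upperSemicontinuous_toCircle hΩ
  rw [← EReal.coe_zero]
  refine EReal.le_of_forall_lt_iff_le.1 fun y hy => ?_
  have hy0 : 0 < y := EReal.coe_lt_coe_iff.1 hy
  set ε : ℝ := y / 6
  have hε : 0 < ε := by positivity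
  have hKc : IsClosed {x : AddCircle (1 : ℝ) | (ε : EReal) ≤ w (toCircle x)} := by
    have := (husc.isOpen_preimage (ε : EReal)).isClosed_compl
    convert this using 1
    ext x; simp
  have hKnull : haarAddCircle {x : AddCircle (1 : ℝ) | (ε : EReal) ≤ w (toCircle x)} = 0 := by
    refine measure_mono_null (fun x hx => ?_) (ae_iff.1 hae)
    exact not_le.2 ((EReal.coe_lt_coe_iff.2 hε).trans_le hx)
  obtain ⟨O, hKO, hO, hOε⟩ := Set.exists_isOpen_lt_of_lt _ (ENNReal.ofReal ε)
    (hKnull.trans_lt (ENNReal.ofReal_pos.2 hε))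
  obtain ⟨χ, hχ0, hχ1, hχ⟩ := exists_continuous_zero_one_of_isClosed hO.isClosed_compl hKc
    (disjoint_left.2 fun x hx hxK => hx (hKO hxK))
  have hint {k : AddCircle (1 : ℝ) → ℝ} (hk : Continuous k) : Integrable k haarAddCircle :=
    hk.integrable_of_hasCompactSupport (HasCompactSupport.of_compactSpace _)
  have hχint : ∫ x, χ x ∂haarAddCircle ≤ ε := by
    have hOr : haarAddCircle.real O ≤ ε := ENNReal.toReal_le_of_le_ofReal hε.le hOε.le
    refine le_trans ?_ hOr
    rw [← integral_indicator_one hO.measurableSet]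
    refine integral_mono (hint χ.continuous) ((integrable_const 1).indicator hO.measurableSet)
      fun x => ?_
    by_cases hx : x ∈ O
    · simpa [hx] using (hχ x).2
    · simpa [hx] using (hχ0 hx).le
  refine (hw.le_three_mul_integral hΩ ⟨fun x => ε + χ x, by fun_prop⟩
    (fun x => add_nonneg hε.le (hχ x).1) (fun x => ?_) hz).trans (EReal.coe_le_coe_iff.2 ?_)
  · simp only [ContinuousMap.coe_mk]
    by_cases hx : (ε : EReal) ≤ w (toCircle x)
    · have : χ x = 1 := hχ1 hx
      refine (h1 _ (hΩ (sphere_subset_closedBall (toCircle_mem_sphere x)))).trans ?_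
      rw [this]
      exact_mod_cast (by linarith : (1 : ℝ) ≤ ε + 1)
    · refine (not_le.1 hx).le.trans (EReal.coe_le_coe_iff.2 ?_)
      linarith [(hχ x).1]
  · simp only [ContinuousMap.coe_mk]
    rw [integral_add (integrable_const _) (hint χ.continuous)]
    simp only [integral_const, probReal_univ, smul_eq_mul, one_mul]
    have : y = 6 * ε := by simp only [ε]; ring
    linarith

theorem PshOn.le_zero_of_ne_bot_complex {v w : ℂ → EReal} {Ω : Set ℂ} (hv : PshOn v univ)
    (h0 : v 0 ≠ ⊥) (hΩ : IsOpen Ω) (h1Ω : 1 ∈ Ω) (hw : PshOn w Ω) (h1 : ∀ t ∈ Ω, w t ≤ 1)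
    (hle : ∀ t ∈ Ω, v t ≠ ⊥ → w t ≤ 0) : w 1 ≤ 0 := by
  obtain ⟨δ, hδ, hball⟩ := Metric.isOpen_iff.1 hΩ 1 h1Ω
  set η : ℝ := δ / 2
  have hη : 0 < η := half_pos hδ
  have hδη : δ = 2 * η := by simp only [η]; ring
  have hcont : Continuous fun x : AddCircle (1 : ℝ) => (toCircle x : ℂ) :=
    continuous_subtype_val.comp continuous_toCircle
  obtain ⟨x, hx, hvx⟩ : ∃ x : AddCircle (1 : ℝ),
      (toCircle x : ℂ) ∈ ball (1 : ℂ) (η / 2) ∧ v (toCircle x) ≠ ⊥ := by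
    by_contra! hcon
    have hU : IsOpen {x : AddCircle (1 : ℝ) | (toCircle x : ℂ) ∈ ball (1 : ℂ) (η / 2)} :=
      isOpen_ball.preimage hcont
    refine (hU.measure_pos haarAddCircle ⟨0, ?_⟩).ne' (measure_mono_null (fun x hx => ?_)
      (ae_iff.1 (hv.ae_ne_bot (subset_univ _) h0)))
    · simpa using hη
    · simpa using hcon x hx
  set t₁ : ℂ := (toCircle x : ℂ)
  have hmaps (s : ℂ) (hs : s ∈ closedBall (0 : ℂ) 1) : t₁ + (η : ℂ) * s ∈ Ω := by
    apply hball
    rw [mem_ball, dist_eq_norm] at hx ⊢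
    have hs' : ‖s‖ ≤ 1 := by simpa using hs
    calc ‖t₁ + η * s - 1‖ = ‖(t₁ - 1) + η * s‖ := by ring_nf
      _ ≤ ‖t₁ - 1‖ + ‖(η : ℂ) * s‖ := norm_add_le _ _
      _ ≤ ‖t₁ - 1‖ + η := by
        rw [norm_mul, Complex.norm_real, Real.norm_of_nonneg hη.le]
        nlinarith
      _ < δ := by linarith
  let L : ℂ →L[ℂ] ℂ := (η : ℂ) • ContinuousLinearMap.id ℂ ℂ
  have hv' : PshOn (fun s => v (t₁ + L s)) univ := hv.comp_affine L t₁ fun _ _ => mem_univ _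
  have hw' : PshOn (fun s => w (t₁ + L s)) (closedBall 0 1) := hw.comp_affine L t₁ hmaps
  have hz : ‖(1 - t₁) / η‖ ≤ 1 / 2 := by
    rw [mem_ball, dist_eq_norm, norm_sub_rev] at hx
    rw [norm_div, Complex.norm_real, Real.norm_of_nonneg hη.le, div_le_iff₀ hη]
    linarith
  have hae := hv'.ae_ne_bot (subset_univ _) (by simpa using hvx)
  have key := hw'.le_zero_of_ae Subset.rfl (fun t ht => h1 _ (hmaps t ht))
    (hae.mono fun y hy => hle _ (hmaps _ (sphere_subset_closedBall (toCircle_mem_sphere y))) hy) hz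
  have hη' : (η : ℂ) ≠ 0 := by exact_mod_cast hη.ne'
  have hL : t₁ + L ((1 - t₁) / η) = 1 := by
    simp [L, mul_div_cancel₀ _ hη']
  rwa [hL] at key

/-- A plurisubharmonic function bounded by `1` that is nonpositive off the `-∞`-locus of an
entire plurisubharmonic function `v ≢ -∞` is nonpositive everywhere. -/
theorem PshOn.le_zero_of_ne_bot {E : Type*} [NormedAddCommGroup E] [NormedSpace ℂ E]
    {v w : E → EReal} {Ω : Set E} (hv : PshOn v univ) {e : E} (he : v e ≠ ⊥) (hΩ : IsOpen Ω)
    (hw : PshOn w Ω) (h1 : ∀ x ∈ Ω, w x ≤ 1) (hle : ∀ x ∈ Ω, v x ≠ ⊥ → w x ≤ 0)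
    {b : E} (hb : b ∈ Ω) : w b ≤ 0 := by
  let L : ℂ →L[ℂ] E := ContinuousLinearMap.toSpanSingleton ℂ (b - e)
  have hL : e + L 1 = b := by simp [L]
  have hw' : PshOn (fun t => w (e + L t)) {t | e + L t ∈ Ω} := hw.comp_affine L e fun _ ht => ht
  have hv' : PshOn (fun t => v (e + L t)) univ := hv.comp_affine L e fun _ _ => mem_univ _
  have key := hv'.le_zero_of_ne_bot_complex (by simpa using he)
    (hΩ.preimage (by fun_prop : Continuous fun t => e + L t))
    (by simpa [hL] using hb) hw' (fun t ht => h1 _ ht) (fun t ht => hle _ ht)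
  rwa [hL] at key

end PshLemmas

/-- Inequality (*) from the proof of Lemma 8(c): with
`C := {(a,b') ∈ A × ℂ^{q-1} : M_{(a,b',·)} polar}` (here `q1 = q-1`), `(a_0,b'_0) ∈ C` and
`U := Δ_{(a_0,b'_0)}(r)`, one has
`h*_{C∩U,U}(a_0,b'_0) ≤ h*_{(A∩Δ_{a_0}(r))×Δ_{b'_0}(r),U}(a_0,b'_0)`. -/
theorem lemma_eight_c_star_inequality
    (p q1 : ℕ) (M : Set ((Fin p → ℂ) × ((Fin q1 → ℂ) × ℂ)))
    (hM : ∀ a : Fin p → ℂ, Pluripolar {w : (Fin q1 → ℂ) × ℂ | (a, w) ∈ M})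
    (A : Set (Fin p → ℂ)) (hA : LocPluriregular A)
    (a0 : Fin p → ℂ) (b0 : Fin q1 → ℂ) (r : ℝ) (hr : 0 < r)
    (hC : (a0, b0) ∈
      {c : (Fin p → ℂ) × (Fin q1 → ℂ) |
        c.1 ∈ A ∧ Pluripolar {t : ℂ | (c.1, (c.2, t)) ∈ M}}) :
    relExtrStar
      ({c : (Fin p → ℂ) × (Fin q1 → ℂ) |
          c.1 ∈ A ∧ Pluripolar {t : ℂ | (c.1, (c.2, t)) ∈ M}} ∩ ball (a0, b0) r)
      (ball (a0, b0) r) (a0, b0) ≤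
    relExtrStar ((A ∩ ball a0 r) ×ˢ ball b0 r) (ball (a0, b0) r) (a0, b0) := by
  rw [← ball_prod_same]
  refine limsup_le_limsup (Eventually.of_forall fun z => ?_)
  refine biSup_mono fun u hu => ?_
  obtain ⟨hpsh, hle1, hle0⟩ := hu
  refine ⟨hpsh, hle1, ?_⟩
  rintro ⟨a, b⟩ ⟨⟨haA, ha⟩, hb⟩
  obtain ⟨v, hv, hvne, hvM⟩ := hM a
  obtain ⟨⟨b₁, t₁⟩, hv₁⟩ := not_forall.1 hvne
  have hvslice : PshOn (fun y : Fin q1 → ℂ => v (y, t₁)) univ := by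
    simpa using hv.comp_affine (ContinuousLinearMap.inl ℂ (Fin q1 → ℂ) ℂ) (0, t₁)
      (Ω' := univ) fun _ _ => mem_univ _
  have huslice : PshOn (fun y : Fin q1 → ℂ => u (a, y)) (ball b0 r) := by
    simpa using hpsh.comp_affine (ContinuousLinearMap.inr ℂ (Fin p → ℂ) (Fin q1 → ℂ)) (a, 0)
      (Ω' := ball b0 r) fun y hy => by simpa using ⟨ha, hy⟩
  refine hvslice.le_zero_of_ne_bot hv₁ isOpen_ball huslice
    (fun y hy => hle1 _ ⟨ha, hy⟩) (fun y hy hvy => hle0 _ ⟨⟨haA, ?_⟩, ha, hy⟩) hb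
  refine ⟨fun t => v (y, t), ?_, fun h => hvy (h t₁), fun t ht => hvM _ ht⟩
  simpa using hv.comp_affine (ContinuousLinearMap.inr ℂ (Fin q1 → ℂ) ℂ) (y, 0)
    (Ω' := univ) fun _ _ => mem_univ _
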